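/- For every integer m ≥ 4, every m-fragile finite simple graph has a proper colouring with at most m colours. -/

import Mathlib

/-- A graph is `k`-connected if it has at least `k+1` vertices and deleting any set of
at most `k-1` vertices leaves a connected (in particular nonempty) graph. -/
def SimpleGraph.IsKConnected {V : Type*} (G : SimpleGraph V) (k : ℕ) : Prop :=
  k + 1 ≤ Nat.card V ∧ ∀ S : Set V, S.ncard ≤ k - 1 → (G.induce Sᶜ).Connected

/-- A graph is fragile if it has no 3-connected subgraph. -/
def SimpleGraph.Fragile {V : Type*} (G : SimpleGraph V) : Prop :=
  ∀ H : G.Subgraph, ¬ H.coe.IsKConnected 3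

/-- A graph is `m`-fragile if every 3-connected subgraph of it is `(m-1)`-colourable. -/
def SimpleGraph.MFragile {V : Type*} (m : ℕ) (G : SimpleGraph V) : Prop :=
  ∀ H : G.Subgraph, H.coe.IsKConnected 3 → H.coe.Colorable (m - 1)

namespace SimpleGraph

variable {V : Type*} {G : SimpleGraph V} {m : ℕ}

/-- `c` restricts to a proper colouring of the subgraph of `G` induced on `s`. -/
def ProperOn (G : SimpleGraph V) (s : Finset V) (c : V → Fin m) : Prop :=
  ∀ a ∈ s, ∀ b ∈ s, G.Adj a b → c a ≠ c b

/-- A strengthening of `m`-colourability of the subgraph induced on `s`, suited to gluing along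
2-separations: it prescribes patterns that can be realised on at most three vertices. -/
structure Flexible (G : SimpleGraph V) (m : ℕ) (s : Finset V) : Prop where
  separate : ∀ u ∈ s, ∀ v ∈ s, ∀ w ∈ s, u ≠ v → u ≠ w →
    ∃ c : V → Fin m, G.ProperOn s c ∧ c u ≠ c v ∧ c u ≠ c w
  unite : ∀ u ∈ s, ∀ v ∈ s, ¬ G.Adj u v → ∃ c : V → Fin m, G.ProperOn s c ∧ c u = c v
  two : ∀ u ∈ s, ∀ v ∈ s, ∀ w ∈ s, u ≠ v → u ≠ w → v ≠ w →
    ¬ G.Adj u v → ¬ G.Adj u w → ¬ G.Adj v w →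
    ∃ c : V → Fin m, G.ProperOn s c ∧
      ((c u = c v ∧ c u ≠ c w) ∨ (c u = c w ∧ c u ≠ c v) ∨ (c v = c w ∧ c u ≠ c v))

/-- `(A, B)` is a separation of order two, with cut `{x, y}`, of the subgraph induced on `s`. -/
structure IsSeparation (G : SimpleGraph V) (s A B : Finset V) (x y : V) : Prop where
  mem_iff : ∀ a, a ∈ s ↔ a ∈ A ∨ a ∈ B
  cut_iff : ∀ a, a ∈ A ∧ a ∈ B ↔ a = x ∨ a = y
  ne : x ≠ y
  left_ssubset : A ⊂ s
  right_ssubset : B ⊂ s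
  not_adj : ∀ a ∈ A, ∀ b ∈ B, a ∉ B → b ∉ A → ¬ G.Adj a b

namespace IsSeparation

variable {s A B : Finset V} {x y : V}

theorem symm (h : G.IsSeparation s A B x y) : G.IsSeparation s B A x y where
  mem_iff a := by rw [h.mem_iff, or_comm]
  cut_iff a := by rw [← h.cut_iff, and_comm]
  ne := h.ne
  left_ssubset := h.right_ssubset
  right_ssubset := h.left_ssubset
  not_adj a ha b hb hab hba hadj := h.not_adj b hb a ha hba hab hadj.symm

theorem x_mem_left (h : G.IsSeparation s A B x y) : x ∈ A := ((h.cut_iff x).2 (.inl rfl)).1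
theorem y_mem_left (h : G.IsSeparation s A B x y) : y ∈ A := ((h.cut_iff y).2 (.inr rfl)).1
theorem x_mem_right (h : G.IsSeparation s A B x y) : x ∈ B := ((h.cut_iff x).2 (.inl rfl)).2
theorem y_mem_right (h : G.IsSeparation s A B x y) : y ∈ B := ((h.cut_iff y).2 (.inr rfl)).2

theorem ne_x (h : G.IsSeparation s A B x y) {u : V} (hu : u ∉ A) : u ≠ x :=
  fun e => hu (e ▸ h.x_mem_left)
theorem ne_y (h : G.IsSeparation s A B x y) {u : V} (hu : u ∉ A) : u ≠ y :=
  fun e => hu (e ▸ h.y_mem_left)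

end IsSeparation

theorem exists_perm_three {α : Type*} [DecidableEq α] {a b c a' b' c' : α}
    (hab : a = b ↔ a' = b') (hca : c = a ↔ c' = a') (hcb : c = b ↔ c' = b') :
    ∃ σ : Equiv.Perm α, σ a = a' ∧ σ b = b' ∧ σ c = c' := by
  obtain ⟨σ, h1⟩ : ∃ σ : Equiv.Perm α, σ a = a' := ⟨Equiv.swap a a', by simp⟩
  obtain ⟨τ, h2, h3⟩ : ∃ τ : Equiv.Perm α, τ a = a' ∧ τ b = b' := by
    refine ⟨σ.trans (Equiv.swap (σ b) b'), ?_, by simp⟩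
    have := σ.injective.eq_iff (a := a) (b := b)
    simp only [Equiv.trans_apply, Equiv.swap_apply_def]
    grind
  refine ⟨τ.trans (Equiv.swap (τ c) c'), ?_, ?_, by simp⟩
  · have := τ.injective.eq_iff (a := c) (b := a)
    simp only [Equiv.trans_apply, Equiv.swap_apply_def]
    grind
  · have := τ.injective.eq_iff (a := c) (b := b)
    simp only [Equiv.trans_apply, Equiv.swap_apply_def]
    grind

theorem exists_notMem_of_card_lt {t : Finset (Fin m)} (ht : t.card < m) : ∃ k, k ∉ t := by
  by_contra! h
  have : t = Finset.univ := Finset.eq_univ_iff_forall.2 h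
  simp [this] at ht

theorem exists_ne_three (hm : 4 ≤ m) (a b c : Fin m) : ∃ k : Fin m, k ≠ a ∧ k ≠ b ∧ k ≠ c := by
  obtain ⟨k, hk⟩ := exists_notMem_of_card_lt (t := {a, b, c})
    (Finset.card_le_three.trans_lt hm)
  exact ⟨k, by simpa using hk⟩

theorem exists_ne_four (hm : 5 ≤ m) (a b c d : Fin m) :
    ∃ k : Fin m, k ≠ a ∧ k ≠ b ∧ k ≠ c ∧ k ≠ d := by
  obtain ⟨k, hk⟩ := exists_notMem_of_card_lt (t := {a, b, c, d})
    (Finset.card_le_four.trans_lt hm)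
  exact ⟨k, by simpa using hk⟩

namespace IsSeparation

variable {s A B : Finset V} {x y : V}

/-- Colourings of the two sides can be glued, after permuting the colours of the second one,
giving the vertex `u` of the second side any colour `k` compatible with the pattern on
`x, y, u`. -/
theorem glue (h : G.IsSeparation s A B x y) {cA cB : V → Fin m} (hA : G.ProperOn A cA)
    (hB : G.ProperOn B cB) {u : V} (hu : u ∈ B) {k : Fin m} (hxy : cB x = cB y ↔ cA x = cA y)
    (hux : cB u = cB x ↔ k = cA x) (huy : cB u = cB y ↔ k = cA y) :
    ∃ c : V → Fin m, G.ProperOn s c ∧ (∀ a ∈ A, c a = cA a) ∧ c u = k := by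
  classical
  obtain ⟨σ, hx, hy, hk⟩ := exists_perm_three hxy hux huy
  have key : ∀ b ∈ B, (if b ∈ A then cA b else σ (cB b)) = σ (cB b) := by
    intro b hb
    split_ifs with hbA
    · rcases (h.cut_iff b).1 ⟨hbA, hb⟩ with rfl | rfl <;> simp [*]
    · rfl
  refine ⟨fun a => if a ∈ A then cA a else σ (cB a), ?_, fun a ha => if_pos ha, ?_⟩
  · intro a ha b hb hab
    by_cases hAA : a ∈ A ∧ b ∈ A
    · simpa [hAA.1, hAA.2] using hA a hAA.1 b hAA.2 hab
    · have haB : a ∈ B ∧ b ∈ B := by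
        have h1 := (h.mem_iff a).1 ha
        have h2 := (h.mem_iff b).1 hb
        have h3 := h.not_adj a
        have h4 := h.not_adj b
        have := hab.symm
        grind
      simp only [key a haB.1, key b haB.2]
      exact fun e => hB a haB.1 b haB.2 hab (σ.injective e)
  · exact (key u hu).trans hk

/-- Variant of `IsSeparation.glue` in which `u` only has to avoid the colour `f`. -/
theorem glue_avoid (h : G.IsSeparation s A B x y) (hm : 4 ≤ m) {cA cB : V → Fin m}
    (hA : G.ProperOn A cA) (hB : G.ProperOn B cB) {u : V} (hu : u ∈ B) {f : Fin m}
    (hxy : cB x = cB y ↔ cA x = cA y) (hux : cB u = cB x → cA x ≠ f)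
    (huy : cB u = cB y → cA y ≠ f) :
    ∃ c : V → Fin m, G.ProperOn s c ∧ (∀ a ∈ A, c a = cA a) ∧ c u ≠ f := by
  obtain ⟨k, hk⟩ : ∃ k, (cB u = cB x ↔ k = cA x) ∧ (cB u = cB y ↔ k = cA y) ∧ k ≠ f := by
    by_cases h1 : cB u = cB x
    · exact ⟨cA x, by grind⟩
    by_cases h2 : cB u = cB y
    · exact ⟨cA y, by grind⟩
    obtain ⟨k, hk⟩ := exists_ne_three hm (cA x) (cA y) f
    exact ⟨k, by grind⟩
  obtain ⟨c, h1, h2, h3⟩ := h.glue hA hB hu hxy hk.1 hk.2.1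
  exact ⟨c, h1, h2, h3 ▸ hk.2.2⟩

end IsSeparation

theorem Flexible.exists_ne {s : Finset V} (hs : G.Flexible m s) {u v : V} (hu : u ∈ s)
    (hv : v ∈ s) (huv : u ≠ v) : ∃ c : V → Fin m, G.ProperOn s c ∧ c u ≠ c v := by
  obtain ⟨c, h, h', -⟩ := hs.separate u hu v hv v hv huv huv
  exact ⟨c, h, h'⟩

/-- Patterns available on three vertices of which the first two are not adjacent. -/
theorem Flexible.patterns {s : Finset V} (hs : G.Flexible m s) {x y u : V} (hx : x ∈ s)
    (hy : y ∈ s) (hu : u ∈ s) (hxy : x ≠ y) (hux : u ≠ x) (huy : u ≠ y) (hadj : ¬ G.Adj x y) :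
    (∃ c : V → Fin m, G.ProperOn s c ∧ c x = c y ∧ c u ≠ c x) ∨
    ((∃ c : V → Fin m, G.ProperOn s c ∧ c x ≠ c y ∧ c u ≠ c x ∧ c u ≠ c y) ∧
      ((∃ c : V → Fin m, G.ProperOn s c ∧ c u = c x ∧ c u ≠ c y) ∨
        ∃ c : V → Fin m, G.ProperOn s c ∧ c u = c y ∧ c u ≠ c x)) := by
  by_contra! hcon
  obtain ⟨h0, h1⟩ := hcon
  obtain ⟨c, hc, hcx, hcy⟩ := hs.separate u hu x hx y hy hux huy
  obtain ⟨d, hd, hdxy⟩ := hs.unite x hx y hy hadj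
  have h2 := h0 d hd hdxy
  have h3 : c x ≠ c y := fun e => hcx (h0 c hc e)
  obtain ⟨h4, h5⟩ := h1 ⟨c, hc, h3, hcx, hcy⟩
  have hxu : ¬ G.Adj x u := fun a => hd x hx u hu a h2.symm
  have hyu : ¬ G.Adj y u := fun a => hd y hy u hu a (hdxy ▸ h2.symm)
  obtain ⟨e, he, h6⟩ := hs.two x hx y hy u hu hxy hux.symm huy.symm hadj hxu hyu
  grind

namespace IsSeparation

variable {s A B : Finset V} {x y : V}

theorem extend (h : G.IsSeparation s A B x y) (hB : G.Flexible m B) {cA : V → Fin m}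
    (hA : G.ProperOn A cA) : ∃ c : V → Fin m, G.ProperOn s c ∧ ∀ a ∈ A, c a = cA a := by
  obtain ⟨cB, hcB, hxy⟩ : ∃ cB : V → Fin m, G.ProperOn B cB ∧ (cB x = cB y ↔ cA x = cA y) := by
    by_cases e : cA x = cA y
    · obtain ⟨c, hc, hc'⟩ := hB.unite x h.x_mem_right y h.y_mem_right
        fun a => hA x h.x_mem_left y h.y_mem_left a e
      exact ⟨c, hc, by grind⟩
    · obtain ⟨c, hc, hc'⟩ := hB.exists_ne h.x_mem_right h.y_mem_right h.ne
      exact ⟨c, hc, by grind⟩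
  obtain ⟨c, h1, h2, -⟩ := h.glue hA hcB h.x_mem_right (k := cA x) hxy (by simp) hxy
  exact ⟨c, h1, h2⟩

theorem unite_across (h : G.IsSeparation s A B x y) (hA : G.Flexible m A) (hB : G.Flexible m B)
    {u v : V} (hu : u ∈ A) (huB : u ∉ B) (hv : v ∈ B) (hvA : v ∉ A) :
    ∃ c : V → Fin m, G.ProperOn s c ∧ c u = c v := by
  have hux := h.symm.ne_x huB
  have huy := h.symm.ne_y huB
  have hvx := h.ne_x hvA
  have hvy := h.ne_y hvA
  have hne := h.ne
  suffices H : ∃ cA cB : V → Fin m, G.ProperOn A cA ∧ G.ProperOn B cB ∧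
      (cB x = cB y ↔ cA x = cA y) ∧ (cB v = cB x ↔ cA u = cA x) ∧
      (cB v = cB y ↔ cA u = cA y) by
    obtain ⟨cA, cB, hcA, hcB, h1, h2, h3⟩ := H
    obtain ⟨c, h4, h5, h6⟩ := h.glue hcA hcB hv h1 h2 h3
    exact ⟨c, h4, by rw [h5 u hu, h6]⟩
  by_cases hxy : G.Adj x y
  · obtain ⟨cA, hcA, h1⟩ := hA.separate u hu x h.x_mem_left y h.y_mem_left hux huy
    obtain ⟨cB, hcB, h2⟩ := hB.separate v hv x h.x_mem_right y h.y_mem_right hvx hvy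
    have h3 := hcA x h.x_mem_left y h.y_mem_left hxy
    have h4 := hcB x h.x_mem_right y h.y_mem_right hxy
    exact ⟨cA, cB, hcA, hcB, by grind⟩
  · obtain ⟨a₁, ha₁, h₁⟩ := hA.separate x h.x_mem_left y h.y_mem_left u hu h.ne hux.symm
    obtain ⟨a₂, ha₂, h₂⟩ := hA.separate y h.y_mem_left x h.x_mem_left u hu h.ne.symm huy.symm
    obtain ⟨b₁, hb₁, h₃⟩ := hB.separate x h.x_mem_right y h.y_mem_right v hv h.ne hvx.symm
    obtain ⟨b₂, hb₂, h₄⟩ := hB.separate y h.y_mem_right x h.x_mem_right v hv h.ne.symm hvy.symm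
    rcases hA.patterns h.x_mem_left h.y_mem_left hu h.ne hux huy hxy with
        ⟨a, ha, h5⟩ | ⟨⟨a, ha, h5⟩, ⟨a', ha', h5'⟩ | ⟨a', ha', h5'⟩⟩ <;>
      rcases hB.patterns h.x_mem_right h.y_mem_right hv h.ne hvx hvy hxy with
        ⟨b, hb, h6⟩ | ⟨⟨b, hb, h6⟩, ⟨b', hb', h6'⟩ | ⟨b', hb', h6'⟩⟩ <;>
      grind

theorem separate_center (h : G.IsSeparation s A B x y) (hm : 4 ≤ m)
    (hK : ∀ a b c d, G.Adj a b → G.Adj a c → G.Adj a d → G.Adj b c → G.Adj b d → G.Adj c d →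
      5 ≤ m)
    (hA : G.Flexible m A) (hB : G.Flexible m B)
    {u v w : V} (hu : u ∈ B) (huA : u ∉ A) (hv : v ∈ A) (hw : w ∈ A) :
    ∃ c : V → Fin m, G.ProperOn s c ∧ c u ≠ c v ∧ c u ≠ c w := by
  have hux := h.ne_x huA
  have huy := h.ne_y huA
  have hx := h.x_mem_left
  have hy := h.y_mem_left
  suffices H : ∃ (cA cB : V → Fin m) (k : Fin m), G.ProperOn A cA ∧ G.ProperOn B cB ∧
      (cB x = cB y ↔ cA x = cA y) ∧ (cB u = cB x ↔ k = cA x) ∧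
      (cB u = cB y ↔ k = cA y) ∧ k ≠ cA v ∧ k ≠ cA w by
    obtain ⟨cA, cB, k, hcA, hcB, h1, h2, h3, hkv, hkw⟩ := H
    obtain ⟨c, h4, h5, h6⟩ := h.glue hcA hcB hu h1 h2 h3
    exact ⟨c, h4, by rwa [h5 v hv, h6], by rwa [h5 w hw, h6]⟩
  by_cases hxy : G.Adj x y
  · obtain ⟨cB, hcB, h2⟩ := hB.separate u hu x h.x_mem_right y h.y_mem_right hux huy
    have h4 := hcB x h.x_mem_right y h.y_mem_right hxy
    obtain ⟨cA, k, hcA, hk⟩ : ∃ (cA : V → Fin m) (k : Fin m), G.ProperOn A cA ∧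
        k ≠ cA x ∧ k ≠ cA y ∧ k ≠ cA v ∧ k ≠ cA w := by
      have merge : ∀ a ∈ A, ∀ b ∈ A, ¬ G.Adj a b → ∀ p q : V,
          ∃ (cA : V → Fin m) (k : Fin m), G.ProperOn A cA ∧
            k ≠ cA a ∧ k ≠ cA b ∧ k ≠ cA p ∧ k ≠ cA q := by
        intro a ha b hb hab p q
        obtain ⟨cA, hcA, e⟩ := hA.unite a ha b hb hab
        obtain ⟨k, hk⟩ := exists_ne_three hm (cA a) (cA p) (cA q)
        exact ⟨cA, k, hcA, by grind⟩
      by_cases hxv : G.Adj x v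
      swap
      · obtain ⟨cA, k, h1⟩ := merge x hx v hv hxv y w
        exact ⟨cA, k, by tauto⟩
      by_cases hxw : G.Adj x w
      swap
      · obtain ⟨cA, k, h1⟩ := merge x hx w hw hxw y v
        exact ⟨cA, k, by tauto⟩
      by_cases hyv : G.Adj y v
      swap
      · obtain ⟨cA, k, h1⟩ := merge y hy v hv hyv x w
        exact ⟨cA, k, by tauto⟩
      by_cases hyw : G.Adj y w
      swap
      · obtain ⟨cA, k, h1⟩ := merge y hy w hw hyw x v
        exact ⟨cA, k, by tauto⟩
      by_cases hvw : G.Adj v w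
      swap
      · obtain ⟨cA, k, h1⟩ := merge v hv w hw hvw x y
        exact ⟨cA, k, by tauto⟩
      obtain ⟨cA, hcA, -⟩ := hA.exists_ne hx hy h.ne
      obtain ⟨k, hk⟩ := exists_ne_four (hK x y v w hxy hxv hxw hyv hyw hvw)
        (cA x) (cA y) (cA v) (cA w)
      exact ⟨cA, k, hcA, hk⟩
    have h3 := hcA x hx y hy hxy
    exact ⟨cA, cB, k, hcA, hcB, by grind⟩
  · rcases hB.patterns h.x_mem_right h.y_mem_right hu h.ne hux huy hxy with
      ⟨b, hb, h6⟩ | ⟨⟨b, hb, h6⟩, hb'⟩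
    · obtain ⟨cA, hcA, e⟩ := hA.unite x hx y hy hxy
      obtain ⟨k, hk⟩ := exists_ne_three hm (cA x) (cA v) (cA w)
      exact ⟨cA, b, k, hcA, hb, by grind⟩
    · obtain ⟨cA, hcA, e⟩ := hA.exists_ne hx hy h.ne
      by_cases hk : ∃ k, k ≠ cA x ∧ k ≠ cA y ∧ k ≠ cA v ∧ k ≠ cA w
      · obtain ⟨k, hk⟩ := hk
        exact ⟨cA, b, k, hcA, hb, by grind⟩
      · obtain ⟨k₁, hk₁⟩ := exists_ne_three hm (cA x) (cA y) (cA v)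
        obtain ⟨k₂, hk₂⟩ := exists_ne_three hm (cA x) (cA y) (cA w)
        have hv' : k₁ = cA w := by
          by_contra hne
          exact hk ⟨k₁, hk₁.1, hk₁.2.1, hk₁.2.2, hne⟩
        have hw' : k₂ = cA v := by
          by_contra hne
          exact hk ⟨k₂, hk₂.1, hk₂.2.1, hne, hk₂.2.2⟩
        rcases hb' with ⟨b', hb', h6'⟩ | ⟨b', hb', h6'⟩
        · exact ⟨cA, b', cA x, hcA, hb', by grind⟩
        · exact ⟨cA, b', cA y, hcA, hb', by grind⟩

/-- If some colouring of `A` does not use the colour `f` on both `x` and `y`, it extends to a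
colouring in which `u` avoids `f`. -/
theorem extend_avoid (h : G.IsSeparation s A B x y) (hm : 4 ≤ m) (hB : G.Flexible m B)
    {cA : V → Fin m} (hA : G.ProperOn A cA) {u : V} (hu : u ∈ B) (huA : u ∉ A) {f : Fin m}
    (hf : ¬ (cA x = f ∧ cA y = f)) :
    ∃ c : V → Fin m, G.ProperOn s c ∧ (∀ a ∈ A, c a = cA a) ∧ c u ≠ f := by
  have hux := h.ne_x huA
  have huy := h.ne_y huA
  have hx := h.x_mem_right
  have hy := h.y_mem_right
  suffices H : ∃ cB : V → Fin m, G.ProperOn B cB ∧ (cB x = cB y ↔ cA x = cA y) ∧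
      (cB u = cB x → cA x ≠ f) ∧ (cB u = cB y → cA y ≠ f) by
    obtain ⟨cB, hcB, h1, h2, h3⟩ := H
    exact h.glue_avoid hm hA hcB hu h1 h2 h3
  by_cases e : cA x = cA y
  · obtain ⟨cB, hcB, h1⟩ := hB.unite x hx y hy
      fun a => hA x h.x_mem_left y h.y_mem_left a e
    exact ⟨cB, hcB, by grind⟩
  by_cases hfx : cA x = f
  · obtain ⟨cB, hcB, h1⟩ := hB.separate x hx y hy u hu h.ne hux.symm
    exact ⟨cB, hcB, by grind⟩
  · obtain ⟨cB, hcB, h1⟩ := hB.separate y hy x hx u hu h.ne.symm huy.symm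
    exact ⟨cB, hcB, by grind⟩

theorem separate_leaf (h : G.IsSeparation s A B x y) (hm : 4 ≤ m)
    (hA : G.Flexible m A) (hB : G.Flexible m B)
    {u v w : V} (hu : u ∈ A) (hv : v ∈ B) (hvA : v ∉ A) (hw : w ∈ A) (huw : u ≠ w) :
    ∃ c : V → Fin m, G.ProperOn s c ∧ c u ≠ c v ∧ c u ≠ c w := by
  have hx := h.x_mem_left
  have hy := h.y_mem_left
  obtain ⟨cA, hcA, h1, h2⟩ : ∃ cA : V → Fin m, G.ProperOn A cA ∧ cA u ≠ cA w ∧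
      ¬ (cA x = cA u ∧ cA y = cA u) := by
    by_cases hux : u = x
    · obtain ⟨cA, hcA, h1⟩ := hA.separate u hu w hw y hy huw (hux ▸ h.ne)
      exact ⟨cA, hcA, by grind⟩
    · obtain ⟨cA, hcA, h1⟩ := hA.separate u hu w hw x hx huw hux
      exact ⟨cA, hcA, by grind⟩
  obtain ⟨c, hc, h3, h4⟩ := h.extend_avoid hm hB hcA hv hvA h2
  exact ⟨c, hc, by grind⟩

theorem two_across (h : G.IsSeparation s A B x y) (hm : 4 ≤ m)
    (hA : G.Flexible m A) (hB : G.Flexible m B)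
    {p q r : V} (hp : p ∈ B) (hpA : p ∉ A) (hq : q ∈ A) (hr : r ∈ A) (hqr : ¬ G.Adj q r) :
    ∃ c : V → Fin m, G.ProperOn s c ∧
      ((c p = c q ∧ c p ≠ c r) ∨ (c p = c r ∧ c p ≠ c q) ∨ (c q = c r ∧ c p ≠ c q)) := by
  have hx := h.x_mem_left
  have hy := h.y_mem_left
  by_cases hex : ∃ cA : V → Fin m, G.ProperOn A cA ∧ cA q = cA r ∧
      ¬ (cA x = cA q ∧ cA y = cA q)
  · obtain ⟨cA, hcA, h1, h2⟩ := hex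
    obtain ⟨c, hc, h3, h4⟩ := h.extend_avoid hm hB hcA hp hpA h2
    exact ⟨c, hc, by grind⟩
  push Not at hex
  obtain ⟨cA, hcA, h1⟩ := hA.unite q hq r hr hqr
  obtain ⟨h2, h3⟩ := hex cA hcA h1
  have hxy : ¬ G.Adj x y := fun a => hcA x hx y hy a (h2.trans h3.symm)
  rcases hB.patterns h.x_mem_right h.y_mem_right hp h.ne (h.ne_x hpA) (h.ne_y hpA) hxy with
    ⟨b, hb, h6⟩ | ⟨⟨b, hb, h6⟩, hb'⟩
  · obtain ⟨c, hc, h4, h5⟩ := h.glue_avoid hm hcA hb hp (f := cA q)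
      (by grind) (by grind) (by grind)
    exact ⟨c, hc, by grind⟩
  obtain ⟨d, hd, hdxy⟩ := hA.exists_ne hx hy h.ne
  have hdqr : d q ≠ d r := fun e => by
    have := hex d hd e
    grind
  suffices H : ∃ (cB : V → Fin m) (k : Fin m), G.ProperOn B cB ∧
      (cB x = cB y ↔ d x = d y) ∧ (cB p = cB x ↔ k = d x) ∧ (cB p = cB y ↔ k = d y) ∧
      (k = d q ∨ k = d r) by
    obtain ⟨cB, k, hcB, h1, h2, h3, hk⟩ := H
    obtain ⟨c, h4, h5, h6⟩ := h.glue hd hcB hp h1 h2 h3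
    exact ⟨c, h4, by grind⟩
  by_cases hq' : d q ≠ d x ∧ d q ≠ d y
  · exact ⟨b, d q, hb, by grind⟩
  by_cases hr' : d r ≠ d x ∧ d r ≠ d y
  · exact ⟨b, d r, hb, by grind⟩
  rcases hb' with ⟨b', hb', h6'⟩ | ⟨b', hb', h6'⟩
  · exact ⟨b', d x, hb', by grind⟩
  · exact ⟨b', d y, hb', by grind⟩

theorem separate (h : G.IsSeparation s A B x y) (hm : 4 ≤ m)
    (hK : ∀ a b c d, G.Adj a b → G.Adj a c → G.Adj a d → G.Adj b c → G.Adj b d → G.Adj c d →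
      5 ≤ m)
    (hA : G.Flexible m A) (hB : G.Flexible m B)
    {u v w : V} (hu : u ∈ s) (hv : v ∈ s) (hw : w ∈ s) (huv : u ≠ v) (huw : u ≠ w) :
    ∃ c : V → Fin m, G.ProperOn s c ∧ c u ≠ c v ∧ c u ≠ c w := by
  rw [h.mem_iff] at hu hv hw
  by_cases hAll : u ∈ A ∧ v ∈ A ∧ w ∈ A
  · obtain ⟨a, ha, h1⟩ := hA.separate u hAll.1 v hAll.2.1 w hAll.2.2 huv huw
    obtain ⟨c, hc, h2⟩ := h.extend hB ha
    exact ⟨c, hc, by grind⟩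
  by_cases hBll : u ∈ B ∧ v ∈ B ∧ w ∈ B
  · obtain ⟨a, ha, h1⟩ := hB.separate u hBll.1 v hBll.2.1 w hBll.2.2 huv huw
    obtain ⟨c, hc, h2⟩ := h.symm.extend hA ha
    exact ⟨c, hc, by grind⟩
  have l₁ := h.separate_center hm hK hA hB (u := u) (v := v) (w := w)
  have l₂ := h.symm.separate_center hm hK hB hA (u := u) (v := v) (w := w)
  have l₃ := h.separate_leaf hm hA hB (u := u) (v := v) (w := w)
  have l₄ := h.symm.separate_leaf hm hB hA (u := u) (v := v) (w := w)
  have l₅ := h.separate_leaf hm hA hB (u := u) (v := w) (w := v)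
  have l₆ := h.symm.separate_leaf hm hB hA (u := u) (v := w) (w := v)
  have swap : (∃ c : V → Fin m, G.ProperOn s c ∧ c u ≠ c w ∧ c u ≠ c v) →
      ∃ c : V → Fin m, G.ProperOn s c ∧ c u ≠ c v ∧ c u ≠ c w :=
    fun ⟨c, h1, h2, h3⟩ => ⟨c, h1, h3, h2⟩
  generalize (∃ c : V → Fin m, G.ProperOn s c ∧ c u ≠ c v ∧ c u ≠ c w) = P at *
  generalize (∃ c : V → Fin m, G.ProperOn s c ∧ c u ≠ c w ∧ c u ≠ c v) = Q at *
  clear hA hB h hK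
  grind

theorem unite (h : G.IsSeparation s A B x y)
    (hA : G.Flexible m A) (hB : G.Flexible m B)
    {u v : V} (hu : u ∈ s) (hv : v ∈ s) (huv : ¬ G.Adj u v) :
    ∃ c : V → Fin m, G.ProperOn s c ∧ c u = c v := by
  rw [h.mem_iff] at hu hv
  by_cases hAll : u ∈ A ∧ v ∈ A
  · obtain ⟨a, ha, h1⟩ := hA.unite u hAll.1 v hAll.2 huv
    obtain ⟨c, hc, h2⟩ := h.extend hB ha
    exact ⟨c, hc, by grind⟩
  by_cases hBll : u ∈ B ∧ v ∈ B
  · obtain ⟨a, ha, h1⟩ := hB.unite u hBll.1 v hBll.2 huv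
    obtain ⟨c, hc, h2⟩ := h.symm.extend hA ha
    exact ⟨c, hc, by grind⟩
  have l₁ := h.unite_across hA hB (u := u) (v := v)
  have l₂ := h.symm.unite_across hB hA (u := u) (v := v)
  tauto

theorem two (h : G.IsSeparation s A B x y) (hm : 4 ≤ m)
    (hA : G.Flexible m A) (hB : G.Flexible m B)
    {u v w : V} (hu : u ∈ s) (hv : v ∈ s) (hw : w ∈ s) (huv : u ≠ v) (huw : u ≠ w) (hvw : v ≠ w)
    (nuv : ¬ G.Adj u v) (nuw : ¬ G.Adj u w) (nvw : ¬ G.Adj v w) :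
    ∃ c : V → Fin m, G.ProperOn s c ∧
      ((c u = c v ∧ c u ≠ c w) ∨ (c u = c w ∧ c u ≠ c v) ∨ (c v = c w ∧ c u ≠ c v)) := by
  rw [h.mem_iff] at hu hv hw
  by_cases hAll : u ∈ A ∧ v ∈ A ∧ w ∈ A
  · obtain ⟨a, ha, h1⟩ := hA.two u hAll.1 v hAll.2.1 w hAll.2.2 huv huw hvw nuv nuw nvw
    obtain ⟨c, hc, h2⟩ := h.extend hB ha
    exact ⟨c, hc, by grind⟩
  by_cases hBll : u ∈ B ∧ v ∈ B ∧ w ∈ B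
  · obtain ⟨a, ha, h1⟩ := hB.two u hBll.1 v hBll.2.1 w hBll.2.2 huv huw hvw nuv nuw nvw
    obtain ⟨c, hc, h2⟩ := h.symm.extend hA ha
    exact ⟨c, hc, by grind⟩
  have rot : ∀ p q r, (p = u ∧ q = v ∧ r = w) ∨ (p = v ∧ q = u ∧ r = w) ∨
      (p = w ∧ q = u ∧ r = v) → (p ∈ B ∧ p ∉ A ∧ q ∈ A ∧ r ∈ A) ∨
        (p ∈ A ∧ p ∉ B ∧ q ∈ B ∧ r ∈ B) → ∃ c : V → Fin m, G.ProperOn s c ∧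
      ((c u = c v ∧ c u ≠ c w) ∨ (c u = c w ∧ c u ≠ c v) ∨ (c v = c w ∧ c u ≠ c v)) := by
    intro p q r hpqr hmem
    have nqr : ¬ G.Adj q r := by
      rcases hpqr with ⟨rfl, rfl, rfl⟩ | ⟨rfl, rfl, rfl⟩ | ⟨rfl, rfl, rfl⟩ <;> assumption
    rcases hmem with ⟨h1, h2, h3, h4⟩ | ⟨h1, h2, h3, h4⟩
    · obtain ⟨c, hc, h5⟩ := h.two_across hm hA hB h1 h2 h3 h4 nqr
      refine ⟨c, hc, ?_⟩
      clear hAll hBll hA hB h hu hv hw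
      grind
    · obtain ⟨c, hc, h5⟩ := h.symm.two_across hm hB hA h1 h2 h3 h4 nqr
      refine ⟨c, hc, ?_⟩
      clear hAll hBll hA hB h hu hv hw
      grind
  have r₁ := rot u v w (.inl ⟨rfl, rfl, rfl⟩)
  have r₂ := rot v u w (.inr (.inl ⟨rfl, rfl, rfl⟩))
  have r₃ := rot w u v (.inr (.inr ⟨rfl, rfl, rfl⟩))
  rcases hu with hu | hu <;> rcases hv with hv | hv <;> rcases hw with hw | hw
  · exact absurd ⟨hu, hv, hw⟩ hAll
  · exact r₃ (.inl ⟨hw, fun h => hAll ⟨hu, hv, h⟩, hu, hv⟩)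
  · exact r₂ (.inl ⟨hv, fun h => hAll ⟨hu, h, hw⟩, hu, hw⟩)
  · exact r₁ (.inr ⟨hu, fun h => hBll ⟨h, hv, hw⟩, hv, hw⟩)
  · exact r₁ (.inl ⟨hu, fun h => hAll ⟨h, hv, hw⟩, hv, hw⟩)
  · exact r₂ (.inr ⟨hv, fun h => hBll ⟨hu, h, hw⟩, hu, hw⟩)
  · exact r₃ (.inr ⟨hw, fun h => hBll ⟨hu, hv, h⟩, hu, hv⟩)
  · exact absurd ⟨hu, hv, hw⟩ hBll

theorem flexible (h : G.IsSeparation s A B x y) (hm : 4 ≤ m)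
    (hK : ∀ a b c d, G.Adj a b → G.Adj a c → G.Adj a d → G.Adj b c → G.Adj b d → G.Adj c d →
      5 ≤ m)
    (hA : G.Flexible m A) (hB : G.Flexible m B) : G.Flexible m s where
  separate _ hu _ hv _ hw := h.separate hm hK hA hB hu hv hw
  unite _ hu _ hv := h.unite hA hB hu hv
  two _ hu _ hv _ hw := h.two hm hA hB hu hv hw

end IsSeparation

/-- A colouring that misses a colour yields all required patterns, by recolouring an independent
set with that colour. -/
theorem flexible_of_unused {s : Finset V} {c : V → Fin m} {k : Fin m} (hc : G.ProperOn s c)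
    (hk : ∀ a ∈ s, c a ≠ k) : G.Flexible m s := by
  classical
  have recolor : ∀ u ∈ s, ∀ v ∈ s, ¬ G.Adj u v → ∃ d : V → Fin m, G.ProperOn s d ∧ d u = k ∧
      d v = k ∧ ∀ w ∈ s, w ≠ u → w ≠ v → d w ≠ k := by
    intro u hu v hv huv
    refine ⟨fun w => if w = u ∨ w = v then k else c w, ?_, by simp, by simp, ?_⟩
    · intro a ha b hb hab
      have h1 := hc a ha b hb hab
      have h2 := hk a ha
      have h3 := hk b hb
      have h4 := hab.ne
      have h5 : ¬ G.Adj v u := fun e => huv e.symm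
      grind
    · intro w hw h1 h2
      simpa [h1, h2] using hk w hw
  refine ⟨fun u hu v hv w hw huv huw => ?_, fun u hu v hv huv => ?_,
    fun u hu v hv w hw huv huw hvw nuv nuw nvw => ?_⟩
  · obtain ⟨d, hd, h1, -, h2⟩ := recolor u hu u hu (G.irrefl)
    exact ⟨d, hd, by grind⟩
  · obtain ⟨d, hd, h1, h2, -⟩ := recolor u hu v hv huv
    exact ⟨d, hd, by grind⟩
  · obtain ⟨d, hd, h1, h2, h3⟩ := recolor u hu v hv nuv
    exact ⟨d, hd, by grind⟩

/-- A vertex cut of order at most two can be enlarged to a separation of order exactly two. -/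
theorem exists_isSeparation_of_cut [DecidableEq V] (n : ℕ) : ∀ {s C S D : Finset V},
    s = C ∪ S ∪ D → Disjoint C S → Disjoint C D → Disjoint S D → C.Nonempty → D.Nonempty →
    (∀ a ∈ C, ∀ b ∈ D, ¬ G.Adj a b) → 4 ≤ s.card → S.card + n = 2 →
    ∃ A B x y, G.IsSeparation s A B x y := by
  induction n with
  | zero =>
    rintro s C S D rfl hCS hCD hSD ⟨c, hc⟩ ⟨d, hd⟩ hadj - hS
    obtain ⟨x, y, hxy, rfl⟩ := Finset.card_eq_two.1 hS
    rw [Finset.disjoint_left] at hCS hCD hSD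
    refine ⟨C ∪ {x, y}, D ∪ {x, y}, x, y, ?_, ?_, hxy, ?_, ?_, ?_⟩
    · grind
    · grind
    · exact Finset.ssubset_iff_subset_ne.2 ⟨by grind, fun e => by
        have : d ∈ C ∪ {x, y} := e ▸ by grind
        grind⟩
    · exact Finset.ssubset_iff_subset_ne.2 ⟨by grind, fun e => by
        have : c ∈ D ∪ {x, y} := e ▸ by grind
        grind⟩
    · grind
  | succ n ih =>
    have step : ∀ {s C S D : Finset V},
        s = C ∪ S ∪ D → Disjoint C S → Disjoint C D → Disjoint S D → D.Nonempty →
        (∀ a ∈ C, ∀ b ∈ D, ¬ G.Adj a b) → 4 ≤ s.card → S.card + (n + 1) = 2 → 2 ≤ C.card →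
        ∃ A B x y, G.IsSeparation s A B x y := by
      intro s C S D hs hCS hCD hSD hD hadj hcard hS hC
      obtain ⟨c, hc⟩ : C.Nonempty := Finset.card_pos.1 (by omega)
      rw [Finset.disjoint_left] at hCS hCD hSD
      refine ih (C := C.erase c) (S := insert c S) (D := D) ?_ ?_ ?_ ?_ ?_ hD ?_ hcard ?_
      · ext a
        simp only [hs, Finset.mem_union, Finset.mem_erase, Finset.mem_insert]
        by_cases hac : a = c
        · subst hac
          simp [hc]
        · simp [hac]
      · rw [Finset.disjoint_left]; grind
      · rw [Finset.disjoint_left]; grind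
      · rw [Finset.disjoint_left]; grind
      · exact Finset.card_pos.1 (by rw [Finset.card_erase_of_mem hc]; omega)
      · grind
      · rw [Finset.card_insert_of_notMem (hCS hc)]; omega
    intro s C S D hs hCS hCD hSD hC hD hadj hcard hS
    have hsum : s.card ≤ C.card + S.card + D.card := by
      rw [hs]
      exact (Finset.card_union_le _ _).trans (Nat.add_le_add_right (Finset.card_union_le _ _) _)
    by_cases h2 : 2 ≤ C.card
    · exact step hs hCS hCD hSD hD hadj hcard hS h2
    · refine step (C := D) (S := S) (D := C) (by rw [hs]; grind) hSD.symm hCD.symm hCS.symm hC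
        (fun a ha b hb e => hadj b hb a ha e.symm) hcard hS (by omega)

/-- An induced subgraph of an `m`-fragile graph has a colouring missing a colour, or it has a
separation of order two. -/
theorem MFragile.unused_or_isSeparation (hG : G.MFragile m) (hm : 4 ≤ m) (s : Finset V) :
    (∃ (c : V → Fin m) (k : Fin m), G.ProperOn s c ∧ ∀ a ∈ s, c a ≠ k) ∨
      ∃ A B x y, G.IsSeparation s A B x y := by
  classical
  obtain ⟨m, rfl⟩ : ∃ n, m = n + 1 := ⟨m - 1, by omega⟩
  have lift : ∀ f : s → Fin m, (∀ a b : s, G.Adj a b → f a ≠ f b) →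
      ∃ (c : V → Fin (m + 1)) (k : Fin (m + 1)), G.ProperOn s c ∧ ∀ a ∈ s, c a ≠ k := by
    intro f hf
    refine ⟨fun v => if hv : v ∈ s then (f ⟨v, hv⟩).castSucc else 0, Fin.last m, ?_, ?_⟩
    · intro a ha b hb hab
      simpa [ha, hb] using hf ⟨a, ha⟩ ⟨b, hb⟩ hab
    · intro a ha
      simp [ha]
  by_cases hs : 4 ≤ s.card
  swap
  · left
    obtain ⟨f⟩ : Nonempty (s ↪ Fin m) :=
      Function.Embedding.nonempty_of_card_le (by simp; omega)
    exact lift f fun a b hab e => hab.ne (congrArg Subtype.val (f.injective e))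
  let H : G.Subgraph := (⊤ : G.Subgraph).induce s
  by_cases hconn : H.coe.IsKConnected 3
  · left
    obtain ⟨f⟩ := hG H hconn
    exact lift (fun a => f ⟨a, a.2⟩) fun a b hab =>
      f.valid (show H.Adj a b from ⟨a.2, b.2, hab⟩)
  right
  have hcard : Nat.card H.verts = s.card :=
    (Nat.card_coe_set_eq _).trans (Set.ncard_coe_finset s)
  simp only [IsKConnected, hcard, not_and, not_forall] at hconn
  obtain ⟨S, hS, hdis⟩ := hconn (by omega)
  have : Finite H.verts := s.finite_toSet
  let K := H.coe.induce Sᶜ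
  have hne : Nonempty ↥(Sᶜ) := by
    rw [Set.nonempty_coe_sort, Set.nonempty_compl]
    rintro rfl
    rw [Set.ncard_univ, hcard] at hS
    omega
  have hpre : ¬ K.Preconnected := fun h => hdis ⟨h⟩
  simp only [Preconnected, not_forall] at hpre
  obtain ⟨a, b, hab⟩ := hpre
  let S' : Finset V := s.filter fun v => ∃ hv : v ∈ H.verts, (⟨v, hv⟩ : H.verts) ∈ S
  let C : Finset V := s.filter fun v => ∃ (hv : v ∈ H.verts) (hS : (⟨v, hv⟩ : H.verts) ∈ Sᶜ),
    K.Reachable a ⟨⟨v, hv⟩, hS⟩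
  let D : Finset V := s.filter fun v => ∃ (hv : v ∈ H.verts) (hS : (⟨v, hv⟩ : H.verts) ∈ Sᶜ),
    ¬ K.Reachable a ⟨⟨v, hv⟩, hS⟩
  have hS' : S'.card ≤ 2 := by
    have : (S' : Set V) ⊆ Subtype.val '' S := by
      intro v hv
      obtain ⟨-, hv, h⟩ := Finset.mem_filter.1 (Finset.mem_coe.1 hv)
      exact ⟨⟨v, hv⟩, h, rfl⟩
    have h1 := Set.ncard_le_ncard this (Set.toFinite _)
    rw [Set.ncard_coe_finset] at h1
    exact h1.trans ((Set.ncard_image_le (Set.toFinite S)).trans hS)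
  refine exists_isSeparation_of_cut (2 - S'.card) (C := C) (S := S') (D := D)
    ?_ ?_ ?_ ?_ ?_ ?_ ?_ hs (by omega)
  · ext v
    simp only [Finset.mem_union, S', C, D, Finset.mem_filter]
    constructor
    · intro hv
      by_cases h1 : (⟨v, hv⟩ : H.verts) ∈ S
      · exact .inl (.inr ⟨hv, hv, h1⟩)
      by_cases h2 : K.Reachable a ⟨⟨v, hv⟩, h1⟩
      · exact .inl (.inl ⟨hv, hv, h1, h2⟩)
      · exact .inr ⟨hv, hv, h1, h2⟩
    · tauto
  · rw [Finset.disjoint_left]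
    simp only [S', C, Finset.mem_filter]
    rintro v ⟨-, _, h1, -⟩ ⟨-, _, h2⟩
    exact h1 h2
  · rw [Finset.disjoint_left]
    simp only [D, C, Finset.mem_filter]
    rintro v ⟨-, _, _, h1⟩ ⟨-, _, _, h2⟩
    exact h2 h1
  · rw [Finset.disjoint_left]
    simp only [S', D, Finset.mem_filter]
    rintro v ⟨-, _, h2⟩ ⟨-, _, h1, -⟩
    exact h1 h2
  · exact ⟨a.1.1, Finset.mem_filter.2 ⟨a.1.2, a.1.2, a.2, Reachable.refl _⟩⟩
  · exact ⟨b.1.1, Finset.mem_filter.2 ⟨b.1.2, b.1.2, b.2, hab⟩⟩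
  · simp only [C, D, Finset.mem_filter]
    rintro p ⟨-, hp, hpS, hpr⟩ q ⟨-, hq, hqS, hqr⟩ hpq
    refine hqr (hpr.trans (Adj.reachable ?_))
    exact show H.Adj p q from ⟨hp, hq, hpq⟩

theorem MFragile.five_le_of_clique (hG : G.MFragile m) (hm : 4 ≤ m) (a b c d : V)
    (hab : G.Adj a b) (hac : G.Adj a c) (had : G.Adj a d) (hbc : G.Adj b c) (hbd : G.Adj b d)
    (hcd : G.Adj c d) : 5 ≤ m := by
  classical
  rcases hG.unused_or_isSeparation hm {a, b, c, d} with ⟨f, k, hf, hk⟩ | ⟨A, B, x, y, h⟩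
  · have h1 : ({k, f a, f b, f c, f d} : Finset (Fin m)).card = 5 := by
      have h2 := hf a (by simp) b (by simp) hab
      have h3 := hf a (by simp) c (by simp) hac
      have h4 := hf a (by simp) d (by simp) had
      have h5 := hf b (by simp) c (by simp) hbc
      have h6 := hf b (by simp) d (by simp) hbd
      have h7 := hf c (by simp) d (by simp) hcd
      have h8 := hk a (by simp)
      have h9 := hk b (by simp)
      have h10 := hk c (by simp)
      have h11 := hk d (by simp)
      grind
    simpa [h1] using Finset.card_le_univ ({k, f a, f b, f c, f d} : Finset (Fin m))
  · obtain ⟨p, hp, hpA⟩ := Finset.exists_of_ssubset h.left_ssubset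
    obtain ⟨q, hq, hqB⟩ := Finset.exists_of_ssubset h.right_ssubset
    have hpB : p ∈ B := ((h.mem_iff p).1 hp).resolve_left hpA
    have hqA : q ∈ A := ((h.mem_iff q).1 hq).resolve_right hqB
    refine absurd ?_ (h.not_adj q hqA p hpB hqB hpA)
    have hne : q ≠ p := fun e => hqB (e ▸ hpB)
    simp only [Finset.mem_insert, Finset.mem_singleton] at hp hq
    rcases hp with rfl | rfl | rfl | rfl <;> rcases hq with rfl | rfl | rfl | rfl <;>
      first | exact absurd rfl hne | assumption | (apply Adj.symm; assumption)

theorem MFragile.flexible (hG : G.MFragile m) (hm : 4 ≤ m) (s : Finset V) : G.Flexible m s := by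
  induction s using Finset.strongInduction with
  | H s ih =>
    rcases hG.unused_or_isSeparation hm s with ⟨c, k, hc, hk⟩ | ⟨A, B, x, y, h⟩
    · exact flexible_of_unused hc hk
    · exact h.flexible hm (hG.five_le_of_clique hm) (ih A h.left_ssubset) (ih B h.right_ssubset)

end SimpleGraph

/-- Every `m`-fragile graph is `m`-colourable. -/
theorem statement7 {V : Type*} [Fintype V] (G : SimpleGraph V) (m : ℕ) (hm : 4 ≤ m)
    (hG : G.MFragile m) : G.Colorable m := by
  rcases isEmpty_or_nonempty V with hV | ⟨⟨v⟩⟩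
  · exact .of_isEmpty m
  · obtain ⟨c, hc, -⟩ := (hG.flexible hm Finset.univ).unite v (Finset.mem_univ v) v
      (Finset.mem_univ v) G.irrefl
    exact ⟨SimpleGraph.Coloring.mk c fun {a b} hab => hc a (Finset.mem_univ a) b (Finset.mem_univ b) hab⟩
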